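/- For every ν ∈ ℤ^d \ {0}, the diagonal Gram matrix entry satisfies G_{νν} = 16π⁴ ‖ν‖₂⁴ r_ν² · [ (a₀ + ρ/(4π²‖ν‖₂²))² + Σ_{τ∈T} ((τ·ν + ‖ν‖₂²)/‖ν‖₂²)² |a_τ|² ]. -/

import Mathlib

open Finset MeasureTheory

noncomputable def fourF (d : ℕ) (ν : Fin d → ℤ) (x : Fin d → ℝ) : ℂ :=
  Complex.exp (2 * (Real.pi : ℂ) * Complex.I * ∑ j, (ν j : ℂ) * (x j : ℂ))

noncomputable def pdv (d : ℕ) (k : Fin d) (f : (Fin d → ℝ) → ℂ) : (Fin d → ℝ) → ℂ :=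
  fun x => fderiv ℝ f x (Pi.single k 1)

noncomputable def lapl (d : ℕ) (f : (Fin d → ℝ) → ℂ) : (Fin d → ℝ) → ℂ :=
  fun x => ∑ k, pdv d k (pdv d k f) x

noncomputable def sqL2 (d : ℕ) (f : (Fin d → ℝ) → ℂ) : ℝ :=
  ∫ x in Set.Icc (0 : Fin d → ℝ) 1, ‖f x‖ ^ 2

noncomputable def sqH2 (d : ℕ) (f : (Fin d → ℝ) → ℂ) : ℝ :=
  sqL2 d f + (∑ k : Fin d, sqL2 d (pdv d k f)) +
    ∑ k : Fin d, ∑ l : Fin d, sqL2 d (pdv d k (pdv d l f))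

noncomputable def enorm2Z (d : ℕ) (ν : Fin d → ℤ) : ℝ := ∑ j, ((ν j : ℝ)) ^ 2

noncomputable def dotZR (d : ℕ) (τ ν : Fin d → ℤ) : ℝ := ∑ j, (τ j : ℝ) * (ν j : ℝ)

noncomputable def Lop (d : ℕ) (a : (Fin d → ℝ) → ℂ) (ρ : ℝ) (u : (Fin d → ℝ) → ℂ) :
    (Fin d → ℝ) → ℂ :=
  fun x => -(∑ k, pdv d k (fun y => a y * pdv d k u y) x) + (ρ : ℂ) * u x

noncomputable def GramM (d : ℕ) (a : (Fin d → ℝ) → ℂ) (ρ : ℝ)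
    (Ψ : (Fin d → ℤ) → (Fin d → ℝ) → ℂ) (ν μ : Fin d → ℤ) : ℂ :=
  ∫ x in Set.Icc (0 : Fin d → ℝ) 1,
    Lop d a ρ (Ψ ν) x * (starRingEnd ℂ) (Lop d a ρ (Ψ μ) x)

lemma fourF_zero (d : ℕ) (x : Fin d → ℝ) : fourF d 0 x = 1 := by
  simp [fourF]

lemma fourF_add (d : ℕ) (σ ν : Fin d → ℤ) (x : Fin d → ℝ) :
    fourF d (σ + ν) x = fourF d σ x * fourF d ν x := by
  simp only [fourF, ← Complex.exp_add, ← mul_add, ← Finset.sum_add_distrib]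
  congr 3 with j
  simp [add_mul]

lemma conj_fourF (d : ℕ) (ν : Fin d → ℤ) (x : Fin d → ℝ) :
    (starRingEnd ℂ) (fourF d ν x) = fourF d (-ν) x := by
  simp [fourF, ← Complex.exp_conj, map_sum, Complex.conj_ofNat]

lemma hasFDerivAt_fourF (d : ℕ) (ν : Fin d → ℤ) (x : Fin d → ℝ) :
    HasFDerivAt (fourF d ν)
      (fourF d ν x • ((2 * (Real.pi : ℂ) * Complex.I) •
        ∑ j, (ν j : ℂ) • Complex.ofRealCLM.comp
          (ContinuousLinearMap.proj (R := ℝ) (φ := fun _ : Fin d => ℝ) j))) x := by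
  have hcoord (j : Fin d) : HasFDerivAt (fun y : Fin d → ℝ => (ν j : ℂ) * (y j : ℂ))
      ((ν j : ℂ) • Complex.ofRealCLM.comp
        (ContinuousLinearMap.proj (R := ℝ) (φ := fun _ : Fin d => ℝ) j)) x :=
    (ContinuousLinearMap.hasFDerivAt (Complex.ofRealCLM.comp
      (ContinuousLinearMap.proj (R := ℝ) (φ := fun _ : Fin d => ℝ) j))).const_mul _
  exact ((HasFDerivAt.fun_sum fun j _ => hcoord j).const_mul _).cexp

lemma continuous_fourF (d : ℕ) (ν : Fin d → ℤ) : Continuous (fourF d ν) :=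
  continuous_iff_continuousAt.2 fun x => (hasFDerivAt_fourF d ν x).continuousAt

lemma pdv_fourF (d : ℕ) (k : Fin d) (ν : Fin d → ℤ) (x : Fin d → ℝ) :
    pdv d k (fourF d ν) x = 2 * (Real.pi : ℂ) * Complex.I * ν k * fourF d ν x := by
  simp only [pdv, (hasFDerivAt_fourF d ν x).fderiv]
  simp [Pi.single_apply, apply_ite Complex.ofReal]
  ring

lemma pdv_sum_fourF {ι : Type*} (d : ℕ) (k : Fin d) (S : Finset ι) (c : ι → ℂ)
    (φ : ι → Fin d → ℤ) (x : Fin d → ℝ) :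
    pdv d k (fun y => ∑ i ∈ S, c i * fourF d (φ i) y) x =
      ∑ i ∈ S, c i * (2 * (Real.pi : ℂ) * Complex.I * φ i k * fourF d (φ i) x) := by
  have h := HasFDerivAt.fun_sum fun i (_ : i ∈ S) =>
    (hasFDerivAt_fourF d (φ i) x).const_mul (c i)
  simp only [← pdv_fourF]
  simp only [pdv, h.fderiv, (hasFDerivAt_fourF d _ x).fderiv]
  simp

lemma setIntegral_exp_int_mul (n : ℤ) :
    ∫ t in Set.Icc (0 : ℝ) 1, Complex.exp (2 * (Real.pi : ℂ) * Complex.I * ((n : ℂ) * (t : ℂ))) =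
      if n = 0 then 1 else 0 := by
  split_ifs with h
  · simp [h]
  · have hne : 2 * (Real.pi : ℂ) * Complex.I * n ≠ 0 := by
      simp [Real.pi_ne_zero, h]
    rw [integral_Icc_eq_integral_Ioc, ← intervalIntegral.integral_of_le zero_le_one]
    simp only [← mul_assoc]
    rw [integral_exp_mul_complex hne]
    have := Complex.exp_int_mul_two_pi_mul_I n
    rw [mul_comm] at this
    simp [this]

lemma setIntegral_fourF (d : ℕ) (ν : Fin d → ℤ) :
    ∫ x in Set.Icc (0 : Fin d → ℝ) 1, fourF d ν x = if ν = 0 then 1 else 0 := by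
  have hprod (x : Fin d → ℝ) : fourF d ν x =
      ∏ j, Complex.exp (2 * (Real.pi : ℂ) * Complex.I * ((ν j : ℂ) * (x j : ℂ))) := by
    rw [fourF, Finset.mul_sum, Complex.exp_sum]
  simp only [hprod]
  rw [← Set.pi_univ_Icc, volume_pi, Measure.restrict_pi_pi,
    integral_fintype_prod_eq_prod
      (f := fun j (t : ℝ) => Complex.exp (2 * (Real.pi : ℂ) * Complex.I * ((ν j : ℂ) * (t : ℂ))))]
  simp only [Pi.zero_apply, Pi.one_apply, setIntegral_exp_int_mul]
  simp [Finset.prod_ite_zero, funext_iff]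

lemma setIntegral_sum_fourF_mul_conj {ι : Type*} [DecidableEq ι] (d : ℕ) (S : Finset ι)
    (c : ι → ℂ) (φ : ι → Fin d → ℤ) (hφ : Function.Injective φ) :
    ∫ x in Set.Icc (0 : Fin d → ℝ) 1, (∑ i ∈ S, c i * fourF d (φ i) x) *
      (starRingEnd ℂ) (∑ i ∈ S, c i * fourF d (φ i) x) = ((∑ i ∈ S, ‖c i‖ ^ 2 : ℝ) : ℂ) := by
  have hexp (x : Fin d → ℝ) : (∑ i ∈ S, c i * fourF d (φ i) x) *
      (starRingEnd ℂ) (∑ i ∈ S, c i * fourF d (φ i) x) =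
      ∑ i ∈ S, ∑ j ∈ S, c i * (starRingEnd ℂ) (c j) * fourF d (φ i - φ j) x := by
    rw [map_sum, Finset.sum_mul_sum]
    refine Finset.sum_congr rfl fun i _ => Finset.sum_congr rfl fun j _ => ?_
    rw [map_mul, conj_fourF, sub_eq_add_neg, fourF_add]
    ring
  have hint (b : ℂ) (ν : Fin d → ℤ) :
      IntegrableOn (fun x => b * fourF d ν x) (Set.Icc (0 : Fin d → ℝ) 1) :=
    ((continuous_fourF d ν).const_mul b).continuousOn.integrableOn_compact isCompact_Icc
  simp only [hexp]
  rw [integral_finsetSum _ fun i _ => integrable_finsetSum _ fun j _ => hint _ _]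
  simp only [integral_finsetSum S fun j _ => hint _ _, integral_const_mul, setIntegral_fourF,
    sub_eq_zero, hφ.eq_iff]
  push_cast
  refine Finset.sum_congr rfl fun i hi => ?_
  simp [hi, Complex.mul_conj']

lemma Lop_fourF (d : ℕ) (S : Finset (Fin d → ℤ)) (b : (Fin d → ℤ) → ℂ) (ρ : ℝ) (s : ℂ)
    (ν : Fin d → ℤ) (x : Fin d → ℝ) :
    Lop d (fun y => ∑ σ ∈ S, b σ * fourF d σ y) ρ (fun y => s * fourF d ν y) x =
      s * (∑ σ ∈ S, 4 * (Real.pi : ℂ) ^ 2 * ((dotZR d σ ν + enorm2Z d ν : ℝ) : ℂ) * b σ *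
        fourF d (σ + ν) x + ρ * fourF d ν x) := by
  have hgrad (k : Fin d) (y : Fin d → ℝ) : pdv d k (fun y => s * fourF d ν y) y =
      s * (2 * (Real.pi : ℂ) * Complex.I * ν k * fourF d ν y) := by
    simpa using pdv_sum_fourF d k {()} (fun _ => s) (fun _ => ν) y
  have hflux (k : Fin d) : (fun y => (∑ σ ∈ S, b σ * fourF d σ y) *
        pdv d k (fun y => s * fourF d ν y) y) =
      fun y => ∑ σ ∈ S, b σ * (s * (2 * (Real.pi : ℂ) * Complex.I * ν k)) *
        fourF d (σ + ν) y := by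
    funext y
    rw [hgrad, Finset.sum_mul]
    refine Finset.sum_congr rfl fun σ _ => ?_
    rw [fourF_add]
    ring
  simp only [Lop, hflux, pdv_sum_fourF]
  rw [Finset.sum_comm, ← Finset.sum_neg_distrib, mul_add, Finset.mul_sum]
  congr 1
  · refine Finset.sum_congr rfl fun σ _ => ?_
    simp only [dotZR, enorm2Z, ← Finset.sum_add_distrib]
    push_cast
    rw [← Finset.sum_neg_distrib, Finset.mul_sum, Finset.sum_mul, Finset.sum_mul,
      Finset.mul_sum]
    refine Finset.sum_congr rfl fun k _ => ?_
    simp only [Pi.add_apply]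
    push_cast
    linear_combination (-4 * b σ * s * (Real.pi : ℂ) ^ 2 * ν k * (σ k + ν k) *
      fourF d (σ + ν) x) * Complex.I_sq
  · ring

theorem stmt3 (d : ℕ) (hd : 1 ≤ d)
    (T : Finset (Fin d → ℤ)) (hT0 : (0 : Fin d → ℤ) ∉ T) (hTsym : ∀ τ ∈ T, -τ ∈ T)
    (a₀ ρ : ℝ) (ha₀ : 0 < a₀) (hρ : 0 < ρ)
    (aC : (Fin d → ℤ) → ℂ) (haSym : ∀ τ ∈ T, aC (-τ) = (starRingEnd ℂ) (aC τ))
    (a : (Fin d → ℝ) → ℂ) (ha : a = fun x => (a₀ : ℂ) + ∑ τ ∈ T, aC τ * fourF d τ x)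
    (r : (Fin d → ℤ) → ℝ)
    (hr : r = fun ν => 1 / (4 * Real.pi ^ 2 * enorm2Z d ν + ρ / a₀))
    (Ψ : (Fin d → ℤ) → (Fin d → ℝ) → ℂ)
    (hΨ : Ψ = fun ν x => (r ν : ℂ) * fourF d ν x) :
    ∀ ν : Fin d → ℤ, ν ≠ 0 →
      GramM d a ρ Ψ ν ν =
        ((16 * Real.pi ^ 4 * (enorm2Z d ν) ^ 2 * (r ν) ^ 2 *
          ((a₀ + ρ / (4 * Real.pi ^ 2 * enorm2Z d ν)) ^ 2 +
            ∑ τ ∈ T, ((dotZR d τ ν + enorm2Z d ν) / enorm2Z d ν) ^ 2 * ‖aC τ‖ ^ 2) : ℝ) : ℂ) := by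
  intro ν hν
  classical
  have hN : 0 < enorm2Z d ν := by
    obtain ⟨j, hj⟩ := Function.ne_iff.1 hν
    have hj : (ν j : ℝ) ≠ 0 := by exact_mod_cast hj
    exact Finset.sum_pos' (fun i _ => sq_nonneg _) ⟨j, Finset.mem_univ j, by positivity⟩
  have hdot0 : dotZR d 0 ν = 0 := by simp [dotZR]
  have ha' : a = fun x => ∑ σ ∈ insert 0 T, (if σ = 0 then (a₀ : ℂ) else aC σ) * fourF d σ x := by
    rw [ha]
    funext x
    rw [Finset.sum_insert hT0, if_pos rfl, fourF_zero, mul_one]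
    congr 1
    exact Finset.sum_congr rfl fun τ hτ => by rw [if_neg (ne_of_mem_of_not_mem hτ hT0)]
  set c : (Fin d → ℤ) → ℂ := fun σ => r ν * (4 * (Real.pi : ℂ) ^ 2 *
    ((dotZR d σ ν + enorm2Z d ν : ℝ) : ℂ) * (if σ = 0 then (a₀ : ℂ) else aC σ) +
      if σ = 0 then (ρ : ℂ) else 0) with hc
  have hL (x : Fin d → ℝ) :
      Lop d a ρ (Ψ ν) x = ∑ σ ∈ insert 0 T, c σ * fourF d (σ + ν) x := by
    rw [ha', hΨ]
    refine (Lop_fourF d _ _ ρ (r ν) ν x).trans ?_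
    simp only [hc, mul_assoc, ← Finset.mul_sum, add_mul, Finset.sum_add_distrib, ite_mul, zero_mul]
    simp
  simp only [GramM, hL]
  rw [setIntegral_sum_fourF_mul_conj d _ c (· + ν) (add_left_injective ν)]
  congr 1
  have hc0 : ‖c 0‖ ^ 2 = (r ν * (4 * Real.pi ^ 2 * enorm2Z d ν * a₀ + ρ)) ^ 2 := by
    have : c 0 = ((r ν * (4 * Real.pi ^ 2 * enorm2Z d ν * a₀ + ρ) : ℝ) : ℂ) := by
      simp [hc, hdot0]
    rw [this, Complex.norm_real, Real.norm_eq_abs, sq_abs]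
  have hcT (τ) (hτ : τ ∈ T) : ‖c τ‖ ^ 2 =
      (r ν * (4 * Real.pi ^ 2 * (dotZR d τ ν + enorm2Z d ν))) ^ 2 * ‖aC τ‖ ^ 2 := by
    have : c τ = ((r ν * (4 * Real.pi ^ 2 * (dotZR d τ ν + enorm2Z d ν)) : ℝ) : ℂ) * aC τ := by
      simp [hc, ne_of_mem_of_not_mem hτ hT0]
      ring
    rw [this, norm_mul, mul_pow, Complex.norm_real, Real.norm_eq_abs, sq_abs]
  rw [Finset.sum_insert hT0, hc0, Finset.sum_congr rfl hcT, mul_add (_ * r ν ^ 2), Finset.mul_sum]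
  have hpi := Real.pi_ne_zero
  congr 1
  · field_simp
    ring
  · refine Finset.sum_congr rfl fun τ _ => ?_
    field_simp
    ring
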